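/- Let p be an odd prime and let G be a non-abelian finite p-group that is an E-group and can be generated by 3 elements. Then the exponent of the derived subgroup G' is strictly less than the exponent of the abelianization G/G'. -/

import Mathlib

/-- A group is an `E`-group if every element commutes with all of its
endomorphic images. -/
def IsEGroup (G : Type*) [Group G] : Prop :=
  ∀ (φ : G →* G) (x : G), x * φ x = φ x * x

section pEGroup
open scoped commutatorElement

lemma ring_anticomm {R : Type*} [Ring R] (A B : R) (hA : A * A = 0) (hB : B * B = 0)
    (hAB : (A + B + A * B) * (A + B + A * B) = 0) : A * B = - (B * A) := by
  have e : A * B + B * A + A * B * A + B * A * B + A * B * A * B = 0 := by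
    have : (A + B + A * B) * (A + B + A * B) = A * A + B * B + A * A * B + A * (B * B) + A * B * A + B * A * B + A * B + B * A + A * B * A * B := by noncomm_ring
    rw [hAB, hA, hB] at this
    simp at this
    rw [eq_comm] at this
    rw [← this]; abel
  have e1 : A * B * A * B = 0 := by
    have h1 : A * (A * B + B * A + A * B * A + B * A * B + A * B * A * B) * B = 0 := by rw [e]; simp
    have h2 : A * (A * B + B * A + A * B * A + B * A * B + A * B * A * B) * B = 
      (A * A) * B * B + A * B * A * B + (A * A) * B * A * B + A * B * A * (B * B) + (A * A) * B * A * B * B := by noncomm_ring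
    rw [h1, hA, hB] at h2
    simpa using h2.symm
  have e2 : A * B * A = 0 := by
    have h1 : A * (A * B + B * A + A * B * A + B * A * B + A * B * A * B) = 0 := by rw [e]; simp
    have h2 : A * (A * B + B * A + A * B * A + B * A * B + A * B * A * B) = 
      (A * A) * B + A * B * A + (A * A) * B * A + A * B * A * B + (A * A) * B * A * B := by noncomm_ring
    rw [h1, hA, e1] at h2
    simpa using h2.symm
  have e3 : B * A * B = 0 := by
    have h1 : (A * B + B * A + A * B * A + B * A * B + A * B * A * B) * B = 0 := by rw [e]; simp
    have h2 : (A * B + B * A + A * B * A + B * A * B + A * B * A * B) * B = 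
      A * (B * B) + B * A * B + A * B * A * B + B * A * (B * B) + A * B * A * (B * B) := by noncomm_ring
    rw [h1, hB, e1] at h2
    simpa using h2.symm
  rw [e1, e2, e3] at e
  simp at e
  exact eq_neg_of_add_eq_zero_left e

section engel
variable {G : Type*} [Group G]

lemma conj_comm (hc : ∀ g x : G, Commute x (g * x * g⁻¹)) (x : G) :
    ∀ m ∈ Subgroup.normalClosure {x}, ∀ m' ∈ Subgroup.normalClosure {x}, m * m' = m' * m := by
  have key : ∀ a ∈ Group.conjugatesOfSet ({x} : Set G), ∀ b ∈ Group.conjugatesOfSet ({x} : Set G), a * b = b * a := by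
    intro a ha b hb
    simp only [Group.mem_conjugatesOfSet_iff, Set.mem_singleton_iff, exists_eq_left, isConj_iff] at ha hb
    obtain ⟨g, rfl⟩ := ha
    obtain ⟨h, rfl⟩ := hb
    have := hc (g⁻¹ * h) x
    have h2 := congrArg (fun t => g * t * g⁻¹) this.eq
    simp only [mul_assoc, mul_inv_rev, inv_inv, mul_inv_cancel_left] at h2 ⊢
    simpa [mul_assoc] using h2
  intro m hm m' hm'
  have I := Subgroup.isMulCommutative_closure key
  exact congrArg Subtype.val (I.is_comm.comm ⟨m, hm⟩ ⟨m', hm'⟩)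

lemma engel_self (hc : ∀ g x : G, Commute x (g * x * g⁻¹)) (y m : G) : Commute y ⁅y, m⁆ := by
  have : ⁅y, m⁆ = y * (m * y * m⁻¹)⁻¹ := by simp [commutatorElement_def, mul_assoc]
  rw [this]
  exact (Commute.refl y).mul_right (hc m y).inv_right

lemma engel_alt (hc : ∀ g x : G, Commute x (g * x * g⁻¹)) (x y z : G) :
    ⁅z, ⁅y, x⁆⁆ = ⁅y, ⁅z, x⁆⁆⁻¹ := by
  let N := Subgroup.normalClosure {x}
  let _ : CommGroup N := { (inferInstance : Group N) with
    mul_comm := fun a b => Subtype.ext (conj_comm hc x a a.2 b b.2) }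
  let ρ : G → AddMonoid.End (Additive N) := fun g => (MulAut.conjNormal g : MulAut N).toMonoidHom.toAdditive
  have hρ : ∀ g h, ρ (g * h) = ρ g * ρ h := by
    intro g h
    ext m
    simp [ρ]
    rfl
  have hcoe : ∀ g (m : N), ((((ρ g - 1) (Additive.ofMul m)).toMul : N) : G) = ⁅g, (m : G)⁆ := by
    intro g m
    have e1 : ((ρ g - 1) (Additive.ofMul m)).toMul = (MulAut.conjNormal g m) / m := rfl
    rw [e1, div_eq_mul_inv, commutatorElement_def]
    rw [Subgroup.coe_mul, Subgroup.coe_inv, MulAut.conjNormal_apply]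
  have hsq : ∀ g, (ρ g - 1) * (ρ g - 1) = 0 := by
    intro g
    ext m
    have h1 := hcoe g m.toMul
    have h2 := hcoe g (((ρ g - 1) m).toMul)
    have : ((((ρ g - 1) ((ρ g - 1) m)).toMul : N) : G) = 1 := by
      refine h2.trans ?_
      rw [commutatorElement_eq_one_iff_commute]
      erw [h1]
      exact engel_self hc _ _
    exact this
  have anti := ring_anticomm (ρ z - 1) (ρ y - 1) (hsq z) (hsq y) (by
    have := hsq (z * y)
    rw [hρ] at this
    have e : ρ z - 1 + (ρ y - 1) + (ρ z - 1) * (ρ y - 1) = ρ z * ρ y - 1 := by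
      rw [sub_mul, mul_sub, mul_one, one_mul]; abel
    rw [e]; exact this)
  let X : N := ⟨x, Subgroup.subset_normalClosure rfl⟩
  have h1 : ((((ρ z - 1) ((ρ y - 1) (Additive.ofMul X))).toMul : N) : G) = ⁅z, ⁅y, x⁆⁆ := by
    refine (hcoe z _).trans ?_
    congr 1
    exact hcoe y X
  have h2 : ((((ρ y - 1) ((ρ z - 1) (Additive.ofMul X))).toMul : N) : G) = ⁅y, ⁅z, x⁆⁆ := by
    refine (hcoe y _).trans ?_
    congr 1
    exact hcoe z X
  rw [← h1, ← h2]
  have := DFunLike.congr_fun anti (Additive.ofMul X)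
  have := congrArg (fun t => ((t.toMul : N) : G)) this
  exact this

lemma engel_swap (hc : ∀ g x : G, Commute x (g * x * g⁻¹)) (x y z : G) :
    ⁅z, ⁅x, y⁆⁆ = ⁅z, ⁅y, x⁆⁆⁻¹ := by
  have hN : ⁅y, x⁆ ∈ Subgroup.normalClosure {x} := by
    rw [commutatorElement_def]
    have hx : x ∈ Subgroup.normalClosure {x} := Subgroup.subset_normalClosure rfl
    exact Subgroup.mul_mem _ (Subgroup.normalClosure_normal.conj_mem _ hx y) (Subgroup.inv_mem _ hx)
  have := conj_comm hc x _ hN _ (Subgroup.normalClosure_normal.conj_mem _ hN z)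
  rw [← commutatorElement_inv y x]
  generalize ⁅y, x⁆ = m at *
  simp only [commutatorElement_def, mul_inv_rev, inv_inv]
  have h2 : m * (z * m⁻¹ * z⁻¹) = (z * m⁻¹ * z⁻¹) * m := by
    have := (show Commute m (z * m * z⁻¹) from this).inv_right
    simpa [mul_assoc] using this.eq
  simp only [mul_assoc] at h2 ⊢
  exact h2.symm

lemma comm_pow_left (hc : ∀ g x : G, Commute x (g * x * g⁻¹)) (x y : G) (n : ℤ) :
    ⁅x ^ n, y⁆ = ⁅x, y⁆ ^ n := by
  have h : ∀ x : G, ⁅x, y⁆ = x * (y * x * y⁻¹)⁻¹ := by simp [commutatorElement_def, mul_assoc]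
  rw [h, h, (hc y x).inv_right.mul_zpow, inv_zpow, conj_zpow]

lemma comm_pow_right (hc : ∀ g x : G, Commute x (g * x * g⁻¹)) (x y : G) (n : ℤ) :
    ⁅x, y ^ n⁆ = ⁅x, y⁆ ^ n := by
  rw [← commutatorElement_inv, comm_pow_left hc, ← commutatorElement_inv x y, inv_zpow, inv_inv]

end engel

/-- commutators of central generators -/
lemma class_two_of_gens {K : Type*} [Group K] (a b c : K) (hgen : Subgroup.closure {a, b, c} = ⊤)
    (h1 : ⁅b, c⁆ ∈ Subgroup.center K) (h2 : ⁅c, a⁆ ∈ Subgroup.center K) (h3 : ⁅a, b⁆ ∈ Subgroup.center K) :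
    ∀ x y : K, ⁅x, y⁆ ∈ Subgroup.center K := by
  have sw : ∀ x y : K, ⁅x, y⁆ ∈ Subgroup.center K → ⁅y, x⁆ ∈ Subgroup.center K := by
    intro x y h
    rw [← commutatorElement_inv]; exact Subgroup.inv_mem _ h
  have sub : ∀ y : K, ⁅a, y⁆ ∈ Subgroup.center K → ⁅b, y⁆ ∈ Subgroup.center K → ⁅c, y⁆ ∈ Subgroup.center K →
      ∀ x : K, ⁅x, y⁆ ∈ Subgroup.center K := by
    intro y ha hb hc x
    have hx : x ∈ Subgroup.closure {a, b, c} := hgen ▸ Subgroup.mem_top x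
    let S := (Subgroup.centralizer {(QuotientGroup.mk' (Subgroup.center K)) y}).comap (QuotientGroup.mk' (Subgroup.center K))
    have hS : ∀ x, x ∈ S ↔ ⁅x, y⁆ ∈ Subgroup.center K := by
      intro x
      rw [Subgroup.mem_comap, Subgroup.mem_centralizer_singleton_iff, ← commutatorElement_eq_one_iff_mul_comm,
        ← map_commutatorElement]
      simp only [QuotientGroup.mk'_apply, QuotientGroup.eq_one_iff]
    rw [← hS]
    refine (Subgroup.closure_le S).2 ?_ hx
    rintro z (rfl | rfl | rfl)
    · exact (hS _).2 ha
    · exact (hS _).2 hb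
    · exact (hS _).2 hc
  have self : ∀ x : K, ⁅x, x⁆ ∈ Subgroup.center K := by intro x; simp
  intro x y
  exact sub y (sw _ _ (sub a (self _) (sw _ _ h3) h2 y)) (sw _ _ (sub b h3 (self _) (sw _ _ h1) y)) 
    (sw _ _ (sub c (sw _ _ h2) h1 (self _) y)) x

lemma exists_surj_zmod {A : Type*} [CommGroup A] [Finite A] (p r : ℕ) (hp : p.Prime)
    (hr : Monoid.exponent A = p ^ (r + 1)) :
    ∃ e : A →* Multiplicative (ZMod (p ^ (r + 1))), Function.Surjective e := by
  obtain ⟨ι, _, n, hn, ⟨E⟩⟩ := CommGroup.equiv_prod_multiplicative_zmod_of_finite A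
  classical
  let pr : ∀ i, A →* Multiplicative (ZMod (n i)) := fun i => (Pi.evalMonoidHom _ i).comp E.toMonoidHom
  have hpr : ∀ i, Function.Surjective (pr i) := by
    intro i
    exact (Function.surjective_eval i).comp E.surjective
  have hdvd : ∀ i, n i ∣ p ^ (r + 1) := by
    intro i
    have h1 : Monoid.exponent (Multiplicative (ZMod (n i))) ∣ Monoid.exponent A :=
      MonoidHom.exponent_dvd (hpr i)
    rw [Monoid.exponent_multiplicative, ZMod.exponent, hr] at h1
    exact h1
  by_cases h : ∃ i, n i = p ^ (r + 1)
  · obtain ⟨i, hi⟩ := h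
    rw [← hi]
    exact ⟨pr i, hpr i⟩
  · exfalso
    push Not at h
    have h2 : ∀ i, n i ∣ p ^ r := by
      intro i
      obtain ⟨k, hk, hk2⟩ := (Nat.dvd_prime_pow hp).1 (hdvd i)
      have : k ≠ r + 1 := fun hh => h i (by rw [hk2, hh])
      rw [hk2]
      exact pow_dvd_pow _ (by omega)
    have h3 : Monoid.exponent A ∣ p ^ r := by
      rw [Monoid.exponent_dvd_iff_forall_pow_eq_one]
      intro g
      apply E.injective
      rw [map_pow, map_one]
      funext i
      rw [Pi.pow_apply, Pi.one_apply]
      obtain ⟨k, hk⟩ := h2 i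
      apply Multiplicative.toAdd.injective
      rw [hk, toAdd_pow]
      simp
    rw [hr] at h3
    have := Nat.le_of_dvd (pow_pos hp.pos _) h3
    have := Nat.pow_lt_pow_right hp.one_lt (Nat.lt_succ_self r)
    simp only [Nat.succ_eq_add_one] at this
    omega

lemma central_of_pow {G : Type*} [Group G] [Finite G] (p r : ℕ) (hp : p.Prime) (hE : IsEGroup G)
    (hr : Monoid.exponent (G ⧸ commutator G) = p ^ r) (u : G) (hu : u ^ (p ^ r) = 1) :
    u ∈ Subgroup.center G := by
  rcases r with _ | r
  · simp at hu; rw [hu]; exact Subgroup.one_mem _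
  obtain ⟨e0, he0⟩ := exists_surj_zmod (A := Abelianization G) p r hp hr
  let e : G →* Multiplicative (ZMod (p ^ (r + 1))) := e0.comp Abelianization.of
  have he : Function.Surjective e := he0.comp (QuotientGroup.mk'_surjective _)
  let ψ : Multiplicative (ZMod (p ^ (r + 1))) →* G :=
    AddMonoidHom.toMultiplicativeLeft (ZMod.lift (p ^ (r + 1)) ⟨(zmultiplesHom (Additive G)) (Additive.ofMul u), by
      simp
      exact_mod_cast hu⟩)
  have hψ : ψ (Multiplicative.ofAdd 1) = u := by
    have := ZMod.lift_coe (p ^ (r + 1)) ⟨(zmultiplesHom (Additive G)) (Additive.ofMul u), by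
      simp
      exact_mod_cast hu⟩ 1
    simp at this
    exact congrArg Additive.toMul this
  have key : ∀ g : G, IsUnit (e g).toAdd → g * u = u * g := by
    intro g hg
    obtain ⟨k, hk⟩ := hg
    let μ : Multiplicative (ZMod (p ^ (r + 1))) →* Multiplicative (ZMod (p ^ (r + 1))) :=
      AddMonoidHom.toMultiplicative (AddMonoidHom.mulLeft ((k⁻¹ : (ZMod (p ^ (r + 1)))ˣ) : ZMod (p ^ (r + 1))))
    have h1 : (ψ.comp (μ.comp e)) g = u := by
      rw [← hψ]
      simp only [MonoidHom.comp_apply]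
      congr 1
      apply Multiplicative.toAdd.injective
      simp [μ, ← hk]
    have := hE (ψ.comp (μ.comp e)) g
    rwa [h1] at this
  obtain ⟨g1, hg1⟩ := he (Multiplicative.ofAdd 1)
  have hk1 := key g1 (by rw [hg1]; simp)
  rw [Subgroup.mem_center_iff]
  intro g
  have : Fact p.Prime := ⟨hp⟩
  by_cases hg : IsUnit (e g).toAdd
  · exact key g hg
  · have h2 := key (g * g1) (by
      rw [map_mul, hg1]
      simp only [toAdd_mul, toAdd_ofAdd]
      have : IsNilpotent (e g).toAdd := by
        obtain ⟨m, hm⟩ := ZMod.intCast_surjective (e g).toAdd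
        rw [← hm] at hg ⊢
        rw [ZMod.coe_int_isUnit_iff_isCoprime] at hg
        have : (p : ℤ) ∣ m := by
          by_contra hc
          apply hg
          push_cast
          apply IsCoprime.pow_left
          exact ((Nat.prime_iff_prime_int.1 hp).coprime_iff_not_dvd).2 hc
        obtain ⟨q, rfl⟩ := this
        refine ⟨r + 1, ?_⟩
        push_cast
        rw [mul_pow]
        have : ((p : ZMod (p ^ (r + 1)))) ^ (r + 1) = 0 := by
          exact_mod_cast ZMod.natCast_self (p ^ (r + 1))
        rw [this, zero_mul]
      exact this.isUnit_add_one)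
    have h3 : g = (g * g1) * g1⁻¹ := by group
    rw [h3]
    exact ((show Commute (g * g1) u from h2).mul_left (show Commute g1 u from hk1).inv_left).eq

lemma int_chain (p k : ℕ) (hp : p.Prime) (i j : ℤ) :
    (∃ s : ℤ, ((p ^ k : ℕ) : ℤ) ∣ i - s * j) ∨ (∃ s : ℤ, ((p ^ k : ℕ) : ℤ) ∣ j - s * i) := by
  have hpi : Prime (p : ℤ) := Nat.prime_iff_prime_int.1 hp
  induction k generalizing i j with
  | zero => left; exact ⟨0, by simp⟩
  | succ k ih =>
    have inv : ∀ i j : ℤ, ¬ (p : ℤ) ∣ i → ∃ s : ℤ, ((p ^ (k + 1) : ℕ) : ℤ) ∣ j - s * i := by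
      intro i j h
      have hc : IsCoprime ((p : ℤ) ^ (k + 1)) i := IsCoprime.pow_left (hpi.coprime_iff_not_dvd.2 h)
      obtain ⟨x, y, hxy⟩ := hc
      refine ⟨j * y, j * x, ?_⟩
      push_cast
      linear_combination j * hxy.symm
    by_cases hi : (p : ℤ) ∣ i
    · by_cases hj : (p : ℤ) ∣ j
      · obtain ⟨i', rfl⟩ := hi
        obtain ⟨j', rfl⟩ := hj
        rcases ih i' j' with ⟨s, q, hs⟩ | ⟨s, q, hs⟩
        · left
          refine ⟨s, q, ?_⟩
          push_cast at hs ⊢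
          linear_combination p * hs
        · right
          refine ⟨s, q, ?_⟩
          push_cast at hs ⊢
          linear_combination p * hs
      · left; exact inv j i hj
    · right; exact inv i j hi

/-- key step for class two. -/
lemma class_two_step {G : Type*} [Group G] (hc : ∀ g x : G, Commute x (g * x * g⁻¹)) (n : ℤ)
    (hcen : ∀ u : G, u ^ n = 1 → u ∈ Subgroup.center G)
    (a b c : G) (s : ℤ) (hs : ⁅b, c⁆ ^ n = (⁅a, c⁆ ^ n) ^ s)
    (ht : ∀ s : ℤ, ⁅b, ⁅a ^ s, c⁆⁆ ∈ Subgroup.center G) (htn : ∀ s : ℤ, ⁅b, ⁅a ^ s, c⁆⁆ ^ n = 1) :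
    ⁅a, ⁅b, c⁆⁆ = 1 := by
  set τ := ⁅b, ⁅a ^ (-s), c⁆⁆ with hτ
  have hτc : ∀ g, Commute τ g := fun g => ((Subgroup.mem_center_iff.1 (ht (-s))) g).symm
  have e : ⁅b * a ^ (-s), c⁆ = τ * (⁅a, c⁆ ^ (-s) * ⁅b, c⁆) := by
    rw [hτ, ← comm_pow_left hc]
    simp only [commutatorElement_def]
    group
  have hN : ∀ y : G, ⁅y, c⁆ ∈ Subgroup.normalClosure {c} := by
    intro y
    rw [commutatorElement_def]
    have hx : c ∈ Subgroup.normalClosure {c} := Subgroup.subset_normalClosure rfl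
    exact Subgroup.mul_mem _ (Subgroup.normalClosure_normal.conj_mem _ hx y) (Subgroup.inv_mem _ hx)
  have hab : Commute ⁅a, c⁆ ⁅b, c⁆ := conj_comm hc c _ (hN a) _ (hN b)
  have h1 : ⁅b * a ^ (-s), c⁆ ^ n = 1 := by
    rw [e, (hτc _).mul_zpow, htn, one_mul, (hab.zpow_left (-s)).mul_zpow, hs, ← zpow_mul, ← zpow_mul, ← zpow_add]
    rw [show -s * n + n * s = 0 by ring, zpow_zero]
  have h2 := (Subgroup.mem_center_iff.1 (hcen _ h1)) a
  rw [e] at h2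
  have h3 : Commute a (τ * (⁅a, c⁆ ^ (-s) * ⁅b, c⁆)) := h2
  have h4 : Commute a ⁅a, c⁆ := engel_self hc a c
  rw [commutatorElement_eq_one_iff_commute]
  have h5 : ⁅b, c⁆ = (⁅a, c⁆ ^ (-s))⁻¹ * (τ⁻¹ * (τ * (⁅a, c⁆ ^ (-s) * ⁅b, c⁆))) := by group
  rw [h5]
  exact (h4.zpow_right _).inv_right.mul_right ((hτc a).symm.inv_right.mul_right h3)

lemma class_two {G : Type*} [Group G] [Finite G] (p r : ℕ) (hp : p.Prime) (hE : IsEGroup G)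
    (hr : Monoid.exponent (G ⧸ commutator G) = p ^ r)
    (a b c : G) (hgen : Subgroup.closure {a, b, c} = ⊤) :
    ∀ x y : G, ⁅x, y⁆ ∈ Subgroup.center G := by
  have hc : ∀ g x : G, Commute x (g * x * g⁻¹) := by
    intro g x
    have := hE (MulAut.conj g).toMonoidHom x
    have h : x * (g * x * g⁻¹) = g * x * g⁻¹ * x := by simpa using this
    exact h
  set n : ℤ := ((p ^ r : ℕ) : ℤ) with hn
  have hcen : ∀ u : G, u ^ n = 1 → u ∈ Subgroup.center G := by
    intro u hu
    apply central_of_pow p r hp hE hr u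
    rw [hn] at hu
    exact_mod_cast hu
  have hpow : ∀ x : G, x ^ n ∈ commutator G := by
    intro x
    rw [← QuotientGroup.eq_one_iff, QuotientGroup.mk_zpow, hn, zpow_natCast, ← hr]
    exact Monoid.pow_exponent_eq_one _
  set t := ⁅c, ⁅b, a⁆⁆ with ht
  have t1 : ⁅b, ⁅c, a⁆⁆ = t⁻¹ := by rw [engel_alt hc]
  have t2 : ⁅c, ⁅a, b⁆⁆ = t⁻¹ := by rw [engel_swap hc]
  have t3 : ⁅a, ⁅c, b⁆⁆ = t := by rw [engel_alt hc, t2, inv_inv]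
  have t4 : ⁅a, ⁅b, c⁆⁆ = t⁻¹ := by rw [engel_swap hc, t3]
  have t5 : ⁅b, ⁅a, c⁆⁆ = t := by rw [engel_swap hc, t1, inv_inv]
  have hcomm : ∀ g ∈ ({a, b, c} : Set G), g ∈ Subgroup.centralizer {t} := by
    rintro g (rfl | rfl | rfl)
    · rw [Subgroup.mem_centralizer_singleton_iff, ← t3]; exact engel_self hc _ _
    · rw [Subgroup.mem_centralizer_singleton_iff, ← t5]; exact engel_self hc _ _
    · rw [Subgroup.mem_centralizer_singleton_iff, ht]; exact engel_self hc _ _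
  have htc : t ∈ Subgroup.center G := by
    rw [Subgroup.mem_center_iff]
    intro g
    have hg : g ∈ Subgroup.closure {a, b, c} := hgen ▸ Subgroup.mem_top g
    exact Subgroup.mem_centralizer_singleton_iff.1 ((Subgroup.closure_le _).2 hcomm hg)
  let T := Subgroup.zpowers t
  have hTc : T ≤ Subgroup.center G := by
    rw [Subgroup.zpowers_le]; exact htc
  have hTn : T.Normal := ⟨fun m hm g => by
    rw [(Subgroup.mem_center_iff.1 (hTc hm)) g, mul_inv_cancel_right]; exact hm⟩
  have hQ : ∀ x y z : G, ⁅z, ⁅x, y⁆⁆ ∈ T := by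
    have hgenQ : Subgroup.closure {(a : G ⧸ T), (b : G ⧸ T), (c : G ⧸ T)} = ⊤ := by
      have := congrArg (Subgroup.map (QuotientGroup.mk' T)) hgen
      rw [MonoidHom.map_closure, Subgroup.map_top_of_surjective _ (QuotientGroup.mk'_surjective T)] at this
      rw [← this]
      congr 1
      simp [Set.image_insert_eq]
    have cen : ∀ m : G, ⁅a, m⁆ ∈ T → ⁅b, m⁆ ∈ T → ⁅c, m⁆ ∈ T → (m : G ⧸ T) ∈ Subgroup.center (G ⧸ T) := by
      intro m h1 h2 h3
      rw [Subgroup.mem_center_iff]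
      intro g
      have hg : g ∈ Subgroup.closure {(a : G ⧸ T), (b : G ⧸ T), (c : G ⧸ T)} := hgenQ ▸ Subgroup.mem_top g
      have aux : ∀ x : G, ⁅x, m⁆ ∈ T → (x : G ⧸ T) ∈ Subgroup.centralizer {(m : G ⧸ T)} := by
        intro x hx
        rw [Subgroup.mem_centralizer_singleton_iff, ← commutatorElement_eq_one_iff_mul_comm]
        rw [← QuotientGroup.eq_one_iff] at hx
        exact hx
      refine Subgroup.mem_centralizer_singleton_iff.1 ((Subgroup.closure_le _).2 ?_ hg)
      rintro z (rfl | rfl | rfl)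
      · exact aux _ h1
      · exact aux _ h2
      · exact aux _ h3
    have htT : t ∈ T := Subgroup.mem_zpowers t
    have self : ∀ x y : G, ⁅x, ⁅x, y⁆⁆ = 1 := fun x y =>
      commutatorElement_eq_one_iff_commute.2 (engel_self hc x y)
    have self' : ∀ x y : G, ⁅x, ⁅y, x⁆⁆ = 1 := fun x y => by rw [engel_swap hc, self, inv_one]
    have all := class_two_of_gens (a : G ⧸ T) b c hgenQ
      (cen ⁅b, c⁆ (by rw [t4]; exact T.inv_mem htT) (by rw [self]; exact T.one_mem) (by rw [self']; exact T.one_mem))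
      (cen ⁅c, a⁆ (by rw [self']; exact T.one_mem) (by rw [t1]; exact T.inv_mem htT) (by rw [self]; exact T.one_mem))
      (cen ⁅a, b⁆ (by rw [self]; exact T.one_mem) (by rw [self']; exact T.one_mem) (by rw [t2]; exact T.inv_mem htT))
    intro x y z
    rw [← QuotientGroup.eq_one_iff]
    have h := (Subgroup.mem_center_iff.1 (all x y)) z
    rw [← commutatorElement_eq_one_iff_mul_comm] at h
    exact h
  have hG' : ∀ d ∈ commutator G, ∀ z, ⁅d, z⁆ ∈ T := by
    intro d hd z
    have hle : commutator G ≤ (Subgroup.center (G ⧸ T)).comap (QuotientGroup.mk' T) := by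
      rw [commutator_def, Subgroup.commutator_le]
      intro x _ y _
      rw [Subgroup.mem_comap, Subgroup.mem_center_iff]
      intro g
      obtain ⟨z, rfl⟩ := QuotientGroup.mk_surjective g
      have h := hQ x y z
      rw [← QuotientGroup.eq_one_iff] at h
      rw [← commutatorElement_eq_one_iff_mul_comm]
      exact h
    have h := (Subgroup.mem_center_iff.1 (hle hd)) (z : G ⧸ T)
    rw [← QuotientGroup.eq_one_iff]
    have h2 := h.symm
    rw [← commutatorElement_eq_one_iff_mul_comm] at h2
    exact h2
  have hpw : ∀ x y : G, ⁅x, y⁆ ^ n ∈ T := by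
    intro x y
    rw [← comm_pow_left hc]
    exact hG' _ (hpow x) y
  have htn : t ^ n = 1 := by
    rw [ht, ← comm_pow_right hc, commutatorElement_eq_one_iff_mul_comm]
    exact (Subgroup.mem_center_iff.1 (hTc (hpw b a))) c
  have hTpow : ∀ τ ∈ T, τ ^ n = 1 := by
    rintro τ ⟨k, rfl⟩
    show (t ^ k) ^ n = 1
    rw [← zpow_mul, mul_comm, zpow_mul, htn, one_zpow]
  have ht1 : t = 1 := by
    obtain ⟨i, hi⟩ := hpw b c
    obtain ⟨j, hj⟩ := hpw a c
    change t ^ i = _ at hi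
    change t ^ j = _ at hj
    have hz : ∀ x y : ℤ, ((p ^ r : ℕ) : ℤ) ∣ x - y → t ^ x = t ^ y := by
      rintro x y ⟨q, hq⟩
      rw [show x = n * q + y by rw [hn, ← hq]; ring, zpow_add, zpow_mul, htn, one_zpow, one_mul]
    rcases int_chain p r hp i j with ⟨s, hs⟩ | ⟨s, hs⟩
    · have := class_two_step hc n hcen a b c s (by rw [← hi, ← hj, hz _ _ hs, ← zpow_mul, mul_comm])
        (fun s => hTc (hQ _ _ _)) (fun s => hTpow _ (hQ _ _ _))
      rw [t4] at this
      simpa using this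
    · have := class_two_step hc n hcen b a c s (by rw [← hi, ← hj, hz _ _ hs, ← zpow_mul, mul_comm])
        (fun s => hTc (hQ _ _ _)) (fun s => hTpow _ (hQ _ _ _))
      rwa [t5] at this
  intro x y
  rw [Subgroup.mem_center_iff]
  intro z
  have := hQ x y z
  obtain ⟨k, hk⟩ := this
  simp only [ht1, one_zpow] at hk
  exact commutatorElement_eq_one_iff_mul_comm.1 hk.symm

section linalg
open Matrix

lemma field_lemma {F : Type*} [Field F] (B : Matrix (Fin 3) (Fin 3) F) (S : Submodule F (Fin 3 → F))
    (hS : S ≠ ⊤) (h : ∀ x, B *ᵥ x ∈ S → ∀ y, x ⨯₃ y ∈ S) : S = ⊥ ∧ B.det ≠ 0 := by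
  obtain ⟨f, hf, hSf⟩ := Submodule.exists_le_ker_of_lt_top S (lt_top_iff_ne_top.2 hS)
  let s : Fin 3 → F := fun i => f (Pi.single i 1)
  have hs : ∀ z, f z = s ⬝ᵥ z := by
    intro z
    conv_lhs => rw [← Finset.univ_sum_single z]
    rw [map_sum, dotProduct]
    refine Finset.sum_congr rfl fun i _ => ?_
    have : (Pi.single i (z i) : Fin 3 → F) = z i • Pi.single i 1 := by
      rw [← Pi.single_smul]; simp
    rw [this, map_smul, smul_eq_mul, mul_comm]
  have hs0 : s ≠ 0 := by
    intro h0
    apply hf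
    ext z
    simp [hs, h0]
  have span1 : ∀ x y : Fin 3 → F, x ≠ 0 → x ⨯₃ y = 0 → y ∈ Submodule.span F {x} := by
    intro x y hx hxy
    have h1 := (crossProduct_ne_zero_iff_linearIndependent (v := x) (w := y)).not
    simp only [ne_eq, not_not] at h1
    have h2 := h1.1 hxy
    rw [LinearIndependent.pair_iff' hx] at h2
    push Not at h2
    exact Submodule.mem_span_singleton.2 h2
  let L := S.mkQ ∘ₗ B.mulVecLin
  have hLker : ∀ x, x ∈ LinearMap.ker L ↔ B *ᵥ x ∈ S := by
    intro x
    simp [L]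
  have hL : LinearMap.ker L ≤ Submodule.span F {s} := by
    intro x hx
    rw [hLker] at hx
    apply span1 s x hs0
    have : ∀ y, y ⬝ᵥ (s ⨯₃ x) = 0 := by
      intro y
      rw [triple_product_permutation, ← hs]
      exact hSf (h x hx y)
    ext i
    have := this (Pi.single i 1)
    simpa using this
  have hd1 : Module.finrank F (LinearMap.ker L) ≤ 1 :=
    (Submodule.finrank_mono hL).trans (finrank_span_singleton hs0).le
  have hbot : LinearMap.ker L = ⊥ := by
    by_contra hne
    obtain ⟨x, hx, hx0⟩ := Submodule.exists_mem_ne_zero_of_ne_bot hne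
    rw [hLker] at hx
    have hk : LinearMap.ker (crossProduct x) ≤ Submodule.span F {x} := by
      intro y hy
      exact span1 x y hx0 hy
    have hk1 := (Submodule.finrank_mono hk).trans (finrank_span_singleton hx0).le
    have hr1 := LinearMap.finrank_range_add_finrank_ker (crossProduct x)
    have hr2 := LinearMap.finrank_range_add_finrank_ker L
    have hle : LinearMap.range (crossProduct x) ≤ S := by
      rintro _ ⟨y, rfl⟩
      exact h x hx y
    have hle' := Submodule.finrank_mono hle
    have hq := Submodule.finrank_quotient_add_finrank S
    have hrq := Submodule.finrank_le (LinearMap.range L)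
    simp only [Module.finrank_fin_fun] at hr1 hr2 hq
    omega
  have hinj : ∀ x, B *ᵥ x = 0 → x = 0 := by
    intro x hx
    have : x ∈ LinearMap.ker L := by rw [hLker, hx]; exact S.zero_mem
    rw [hbot] at this
    exact (Submodule.mem_bot F).1 this
  have hdet : B.det ≠ 0 := by
    intro h0
    obtain ⟨v, hv, hv2⟩ := Matrix.exists_mulVec_eq_zero_iff.2 h0
    exact hv (hinj v hv2)
  refine ⟨?_, hdet⟩
  rw [eq_bot_iff]
  intro z hz
  have hz2 : B *ᵥ (B⁻¹ *ᵥ z) = z := by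
    rw [mulVec_mulVec, Matrix.mul_nonsing_inv _ (isUnit_iff_ne_zero.2 hdet), one_mulVec]
  have : B⁻¹ *ᵥ z ∈ LinearMap.ker L := by rw [hLker, hz2]; exact hz
  rw [hbot, Submodule.mem_bot] at this
  rw [← hz2, this]
  simp

lemma scalar_lemma {R : Type*} [CommRing R] (M : Matrix (Fin 3) (Fin 3) R)
    (h : ∀ x, x ⨯₃ (M *ᵥ x) = 0) : M = (M 0 0) • (1 : Matrix (Fin 3) (Fin 3) R) := by
  have h0 := h ![1, 0, 0]
  have h1 := h ![0, 1, 0]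
  have h2 := h ![0, 0, 1]
  have h3 := h ![1, 1, 0]
  have h4 := h ![1, 0, 1]
  simp [cross_apply, mulVec, dotProduct, Fin.sum_univ_three] at h0 h1 h2 h3 h4
  ext i j
  fin_cases i <;> fin_cases j <;> simp <;> grind

lemma isometry_lemma {R : Type*} [CommRing R] (B M : Matrix (Fin 3) (Fin 3) R)
    (h : Mᵀ * B * M = B) (hd : M.det = 1) : M.adjugateᵀ * B = B * M := by
  conv_lhs => rw [← h]
  rw [← Matrix.mul_assoc, ← Matrix.mul_assoc, ← transpose_mul, mul_adjugate, hd]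
  simp

lemma exists_isometry {R : Type*} [CommRing R] [IsLocalRing R] (h2 : IsUnit (2 : R))
    (B : Matrix (Fin 3) (Fin 3) R) (hB : IsUnit B.det) :
    ∃ M : Matrix (Fin 3) (Fin 3) R, M.adjugateᵀ * B = B * M ∧ ¬ ∀ x, x ⨯₃ (M *ᵥ x) = 0 := by
  have hBT : IsUnit Bᵀ.det := by rwa [det_transpose]
  by_cases hsym : Bᵀ = B
  · obtain ⟨v, hv⟩ : ∃ v : Fin 3 → R, IsUnit (v ⬝ᵥ (B *ᵥ v)) := by
      by_contra hcon
      push Not at hcon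
      have hmem : ∀ v : Fin 3 → R, v ⬝ᵥ (B *ᵥ v) ∈ IsLocalRing.maximalIdeal R := by
        intro v
        rw [IsLocalRing.mem_maximalIdeal]
        exact hcon v
      have hd0 := hmem ![1, 0, 0]
      have hd1 := hmem ![0, 1, 0]
      have hd2 := hmem ![0, 0, 1]
      have hd3 := hmem ![1, 1, 0]
      have hd4 := hmem ![1, 0, 1]
      have hd5 := hmem ![0, 1, 1]
      have s1 : B 1 0 = B 0 1 := congrFun (congrFun hsym 0) 1
      have s2 : B 2 0 = B 0 2 := congrFun (congrFun hsym 0) 2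
      have s3 : B 2 1 = B 1 2 := congrFun (congrFun hsym 1) 2
      simp [mulVec, dotProduct, Fin.sum_univ_three] at hd0 hd1 hd2 hd3 hd4 hd5
      set I := IsLocalRing.maximalIdeal R
      have q : ∀ x : R, 2 * x ∈ I → x ∈ I := by
        intro x hx
        exact ((IsLocalRing.maximalIdeal.isMaximal R).isPrime.mem_or_mem hx).resolve_left
          (fun hh => (IsLocalRing.mem_maximalIdeal _).1 hh h2)
      have m01 : B 0 1 ∈ I := q _ (by
        have := I.sub_mem (I.sub_mem hd3 hd0) hd1
        convert this using 1
        rw [s1]; ring)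
      have m02 : B 0 2 ∈ I := q _ (by
        have := I.sub_mem (I.sub_mem hd4 hd0) hd2
        convert this using 1
        rw [s2]; ring)
      have m12 : B 1 2 ∈ I := q _ (by
        have := I.sub_mem (I.sub_mem hd5 hd1) hd2
        convert this using 1
        rw [s3]; ring)
      have : B.det ∈ I := by
        rw [det_fin_three]
        have e : B 0 0 * B 1 1 * B 2 2 - B 0 0 * B 1 2 * B 2 1 - B 0 1 * B 1 0 * B 2 2 + B 0 1 * B 1 2 * B 2 0 +
            B 0 2 * B 1 0 * B 2 1 - B 0 2 * B 1 1 * B 2 0 = (B 1 1 * B 2 2 - B 1 2 * B 2 1) * B 0 0 +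
            (B 1 2 * B 2 0 - B 1 0 * B 2 2) * B 0 1 + (B 1 0 * B 2 1 - B 1 1 * B 2 0) * B 0 2 := by ring
        rw [e]
        exact I.add_mem (I.add_mem (I.mul_mem_left _ hd0) (I.mul_mem_left _ m01)) (I.mul_mem_left _ m02)
      exact (IsLocalRing.mem_maximalIdeal _).1 this hB
    set w := B *ᵥ v with hw
    obtain ⟨c', hc'⟩ := hv.exists_left_inv
    let c := 2 * c'
    have hc : c * (v ⬝ᵥ w) = 2 := by simp only [c]; rw [mul_assoc, hc', mul_one]
    have hvB : v ᵥ* B = w := by rw [hw, ← vecMul_transpose, hsym]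
    let M := c • vecMulVec v w - 1
    have hMT : Mᵀ = c • vecMulVec w v - 1 := by
      simp [M, transpose_sub, transpose_smul, transpose_vecMulVec]
    have hiso : Mᵀ * B * M = B := by
      rw [hMT]
      simp only [M]
      have e1 : vecMulVec w v * B = vecMulVec w w := by rw [vecMulVec_mul, hvB]
      have e2 : B * vecMulVec v w = vecMulVec w w := by rw [mul_vecMulVec]
      have e3 : vecMulVec w w * vecMulVec v w = (v ⬝ᵥ w) • vecMulVec w w := by
        rw [vecMulVec_mul_vecMulVec, dotProduct_comm v w]
        ext i j; simp [vecMulVec_apply]; try ring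
      rw [sub_mul, one_mul, smul_mul_assoc, e1, mul_sub, mul_one, sub_mul, mul_smul_comm, mul_smul_comm,
        smul_mul_assoc, e2, e3, smul_smul c (v ⬝ᵥ w), hc, smul_smul]
      ext i j
      simp
      ring
    have hdet : M.det = 1 := by
      have : c * (v 0 * w 0 + v 1 * w 1 + v 2 * w 2) = 2 := by
        rw [← hc, dotProduct, Fin.sum_univ_three]
      rw [det_fin_three]
      simp [M, vecMulVec_apply]
      linear_combination this
    refine ⟨M, isometry_lemma B M hiso hdet, ?_⟩
    intro hall
    have hsc := scalar_lemma M hall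
    have hMv : M *ᵥ v = v := by
      simp only [M]
      rw [sub_mulVec, smul_mulVec, vecMulVec_mulVec, one_mulVec, dotProduct_comm w v]
      ext i
      simp
      linear_combination v i * hc
    have hu : IsUnit (v ⬝ᵥ w) := hv
    have h00 : M 0 0 = 1 := by
      rw [hsc, smul_mulVec, one_mulVec] at hMv
      have : M 0 0 * (v ⬝ᵥ w) = v ⬝ᵥ w := by
        rw [← smul_eq_mul, ← smul_dotProduct, hMv]
      exact hu.mul_right_cancel (by rw [this, one_mul])
    rw [h00, one_smul] at hsc
    have hvw : ∀ i j, c * (v i * w j) = (1 : Matrix (Fin 3) (Fin 3) R) i j + (1 : Matrix (Fin 3) (Fin 3) R) i j := by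
      intro i j
      have := congrFun (congrFun hsc i) j
      simp [M, vecMulVec_apply] at this
      linear_combination this
    have a1 := hvw 0 0
    have a2 := hvw 1 1
    have a3 := hvw 0 1
    simp at a1 a2 a3
    have : (2 : R) * 2 = 0 := by linear_combination (-(c * (v 1 * w 1))) * a1 - 2 * a2 + c * v 1 * w 0 * a3
    have hu4 : IsUnit ((2 : R) * 2) := h2.mul h2
    rw [this] at hu4
    exact not_isUnit_zero hu4
  · let M := B⁻¹ * Bᵀ
    have hBi : B * B⁻¹ = 1 := mul_nonsing_inv B hB
    have hBTi : Bᵀ⁻¹ * Bᵀ = 1 := nonsing_inv_mul _ hBT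
    have hBM : B * M = Bᵀ := by simp only [M]; rw [← mul_assoc, hBi, one_mul]
    have hiso : Mᵀ * B * M = B := by
      rw [mul_assoc, hBM]
      simp only [M]
      rw [transpose_mul, transpose_transpose, transpose_nonsing_inv, mul_assoc, hBTi, mul_one]
    have hdet : M.det = 1 := by
      have := congrArg det hBM
      rw [det_mul, det_transpose] at this
      exact hB.mul_left_cancel (by rw [this, mul_one])
    refine ⟨M, isometry_lemma B M hiso hdet, ?_⟩
    intro hall
    have hsc := scalar_lemma M hall
    set c := M 0 0 with hc
    rw [hsc, mul_smul_comm, mul_one] at hBM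
    have hcc : (c * c) • B = B := by
      have := congrArg transpose hBM
      rw [transpose_smul, transpose_transpose, ← hBM, smul_smul] at this
      exact this
    have c2 : c * c = 1 := by
      have := congrArg (· * B⁻¹) hcc
      simp only [smul_mul_assoc, hBi] at this
      have := congrFun (congrFun this 0) 0
      simpa using this
    have c3 : c ^ 3 = 1 := by
      have := hdet
      rw [hsc, det_smul] at this
      simpa using this
    have c1 : c = 1 := by linear_combination c3 - c * c2
    rw [c1, one_smul] at hBM
    exact hsym hBM.symm

end linalg

section normalform
open scoped Matrix

variable {K : Type*} [Group K]

def gam (a b c : K) (x : Fin 3 → ℤ) : K := a ^ x 0 * b ^ x 1 * c ^ x 2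
def kap (a b c : K) (z : Fin 3 → ℤ) : K := ⁅b, c⁆ ^ z 0 * ⁅c, a⁆ ^ z 1 * ⁅a, b⁆ ^ z 2

lemma c2_mul_left (hZ : ∀ x y : K, ⁅x, y⁆ ∈ Subgroup.center K) (x y z : K) :
    ⁅x * y, z⁆ = ⁅x, z⁆ * ⁅y, z⁆ := by
  have h1 := Subgroup.mem_center_iff.1 (hZ y z) x
  have h2 := Subgroup.mem_center_iff.1 (hZ y z) ⁅x, z⁆
  have : ⁅x * y, z⁆ = x * ⁅y, z⁆ * x⁻¹ * ⁅x, z⁆ := by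
    simp only [commutatorElement_def]; group
  rw [this, h1, mul_inv_cancel_right, h2]

lemma c2_mul_right (hZ : ∀ x y : K, ⁅x, y⁆ ∈ Subgroup.center K) (x y z : K) :
    ⁅z, x * y⁆ = ⁅z, x⁆ * ⁅z, y⁆ := by
  rw [← commutatorElement_inv, c2_mul_left hZ, mul_inv_rev, commutatorElement_inv, commutatorElement_inv]
  exact Subgroup.mem_center_iff.1 (hZ z x) _

lemma c2_engel (hZ : ∀ x y : K, ⁅x, y⁆ ∈ Subgroup.center K) : ∀ g x : K, Commute x (g * x * g⁻¹) := by
  intro g x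
  have e : g * x * g⁻¹ = ⁅g, x⁆ * x := by simp [commutatorElement_def]
  rw [e]
  exact Commute.mul_right (Subgroup.mem_center_iff.1 (hZ g x) x) (Commute.refl x)

lemma kap_mem (hZ : ∀ x y : K, ⁅x, y⁆ ∈ Subgroup.center K) (a b c : K) (z : Fin 3 → ℤ) :
    kap a b c z ∈ Subgroup.center K :=
  Subgroup.mul_mem _ (Subgroup.mul_mem _ (Subgroup.zpow_mem _ (hZ _ _) _) (Subgroup.zpow_mem _ (hZ _ _) _))
    (Subgroup.zpow_mem _ (hZ _ _) _)

lemma kap_add (hZ : ∀ x y : K, ⁅x, y⁆ ∈ Subgroup.center K) (a b c : K) (x y : Fin 3 → ℤ) :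
    kap a b c (x + y) = kap a b c x * kap a b c y := by
  have comm : ∀ (x y g : K) (n : ℤ), Commute g (⁅x, y⁆ ^ n) := fun x y g n =>
    Commute.zpow_right (Subgroup.mem_center_iff.1 (hZ x y) g) n
  simp only [kap, Pi.add_apply, zpow_add]
  generalize hu0 : ⁅b, c⁆ ^ x 0 = u0
  generalize hu1 : ⁅b, c⁆ ^ y 0 = u1
  generalize hv0 : ⁅c, a⁆ ^ x 1 = v0
  generalize hv1 : ⁅c, a⁆ ^ y 1 = v1
  generalize hw0 : ⁅a, b⁆ ^ x 2 = w0
  generalize ⁅a, b⁆ ^ y 2 = w1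
  have e1 : Commute (v0 * w0) u1 := hu1 ▸ comm _ _ _ _
  have e2 : Commute w0 v1 := hv1 ▸ comm _ _ _ _
  calc u0 * u1 * (v0 * v1) * (w0 * w1) = u0 * u1 * v0 * (v1 * w0) * w1 := by group
    _ = u0 * (u1 * (v0 * w0)) * v1 * w1 := by rw [← e2.eq]; group
    _ = u0 * v0 * w0 * (u1 * v1 * w1) := by rw [← e1.eq]; group

lemma kap_zero (a b c : K) : kap a b c 0 = 1 := by simp [kap]

def kapHom (hZ : ∀ x y : K, ⁅x, y⁆ ∈ Subgroup.center K) (a b c : K) : Multiplicative (Fin 3 → ℤ) →* K where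
  toFun z := kap a b c z.toAdd
  map_one' := kap_zero a b c
  map_mul' x y := kap_add hZ a b c x.toAdd y.toAdd

lemma kap_smul (hZ : ∀ x y : K, ⁅x, y⁆ ∈ Subgroup.center K) (a b c : K) (n : ℤ) (x : Fin 3 → ℤ) :
    kap a b c (n • x) = kap a b c x ^ n :=
  map_zpow (kapHom hZ a b c) (Multiplicative.ofAdd x) n

lemma kap_neg (hZ : ∀ x y : K, ⁅x, y⁆ ∈ Subgroup.center K) (a b c : K) (x : Fin 3 → ℤ) :
    kap a b c (-x) = (kap a b c x)⁻¹ :=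
  map_inv (kapHom hZ a b c) (Multiplicative.ofAdd x)

lemma comm_gam_right (hZ : ∀ x y : K, ⁅x, y⁆ ∈ Subgroup.center K) (g a b c : K) (x : Fin 3 → ℤ) :
    ⁅g, gam a b c x⁆ = ⁅g, a⁆ ^ x 0 * ⁅g, b⁆ ^ x 1 * ⁅g, c⁆ ^ x 2 := by
  have he := c2_engel hZ
  rw [gam, c2_mul_right hZ, c2_mul_right hZ, comm_pow_right he, comm_pow_right he, comm_pow_right he]

lemma comm_gam_left (hZ : ∀ x y : K, ⁅x, y⁆ ∈ Subgroup.center K) (g a b c : K) (x : Fin 3 → ℤ) :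
    ⁅gam a b c x, g⁆ = ⁅a, g⁆ ^ x 0 * ⁅b, g⁆ ^ x 1 * ⁅c, g⁆ ^ x 2 := by
  have he := c2_engel hZ
  rw [gam, c2_mul_left hZ, c2_mul_left hZ, comm_pow_left he, comm_pow_left he, comm_pow_left he]

lemma kap_0 (a b c : K) : ⁅b, c⁆ = kap a b c ![1, 0, 0] := by simp [kap]
lemma kap_1 (a b c : K) : ⁅c, a⁆ = kap a b c ![0, 1, 0] := by simp [kap]
lemma kap_2 (a b c : K) : ⁅a, b⁆ = kap a b c ![0, 0, 1] := by simp [kap]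
lemma kap_0' (a b c : K) : ⁅c, b⁆ = kap a b c ![-1, 0, 0] := by simp [kap]
lemma kap_1' (a b c : K) : ⁅a, c⁆ = kap a b c ![0, -1, 0] := by simp [kap]
lemma kap_2' (a b c : K) : ⁅b, a⁆ = kap a b c ![0, 0, -1] := by simp [kap]

lemma comm_gam_gam (hZ : ∀ x y : K, ⁅x, y⁆ ∈ Subgroup.center K) (a b c : K) (x y : Fin 3 → ℤ) :
    ⁅gam a b c x, gam a b c y⁆ = kap a b c (x ⨯₃ y) := by
  rw [comm_gam_right hZ, comm_gam_left hZ, comm_gam_left hZ, comm_gam_left hZ]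
  rw [kap_0' a b c, kap_1' a b c, kap_2' a b c, kap_0 a b c, kap_1 a b c, kap_2 a b c]
  simp only [commutatorElement_self, one_zpow, one_mul, mul_one]
  simp only [← kap_smul hZ, ← kap_add hZ]
  congr 1
  ext i
  fin_cases i <;> simp [cross_apply] <;> ring

lemma zpow_swap (hZ : ∀ x y : K, ⁅x, y⁆ ∈ Subgroup.center K) (b a : K) (i j : ℤ) :
    b ^ i * a ^ j = a ^ j * b ^ i * ⁅b, a⁆ ^ (i * j) := by
  have he := c2_engel hZ
  have h1 : b ^ i * a ^ j = ⁅b ^ i, a ^ j⁆ * (a ^ j * b ^ i) := by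
    simp only [commutatorElement_def]; group
  rw [h1, comm_pow_left he, comm_pow_right he, ← zpow_mul, mul_comm j i]
  exact (Subgroup.mem_center_iff.1 (Subgroup.zpow_mem _ (hZ b a) _) _).symm

lemma normal_form (hZ : ∀ x y : K, ⁅x, y⁆ ∈ Subgroup.center K) (a b c : K) (g : K)
    (hg : g ∈ Subgroup.closure {a, b, c}) : ∃ x z, g = gam a b c x * kap a b c z := by
  have cen : ∀ (x y g : K) (n : ℤ), ⁅x, y⁆ ^ n * g = g * ⁅x, y⁆ ^ n := fun x y g n =>
    (Subgroup.mem_center_iff.1 (Subgroup.zpow_mem _ (hZ x y) n) g).symm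
  have ha : ∀ (n : ℤ) x, a ^ n * gam a b c x = gam a b c (x + ![n, 0, 0]) * kap a b c 0 := by
    intro n x
    simp [gam, kap_zero]
    rw [add_comm, zpow_add]; group
  have hb : ∀ (n : ℤ) x, b ^ n * gam a b c x = gam a b c (x + ![0, n, 0]) * kap a b c ((n * x 0) • ![0, 0, -1]) := by
    intro n x
    rw [kap_smul hZ, ← kap_2']
    simp only [gam]
    rw [← mul_assoc, ← mul_assoc, zpow_swap hZ, mul_assoc, mul_assoc, cen, ← mul_assoc]
    simp
    rw [add_comm, zpow_add]; group
  have hc : ∀ (n : ℤ) x, c ^ n * gam a b c x = gam a b c (x + ![0, 0, n]) *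
      kap a b c ((n * x 1) • ![-1, 0, 0] + (n * x 0) • ![0, 1, 0]) := by
    intro n x
    rw [kap_add hZ, kap_smul hZ, kap_smul hZ, ← kap_1, ← kap_0']
    simp only [gam]
    calc c ^ n * (a ^ x 0 * b ^ x 1 * c ^ x 2) = (c ^ n * a ^ x 0) * b ^ x 1 * c ^ x 2 := by group
      _ = a ^ x 0 * c ^ n * (⁅c, a⁆ ^ (n * x 0) * (b ^ x 1 * c ^ x 2)) := by rw [zpow_swap hZ]; simp only [mul_assoc]
      _ = a ^ x 0 * (c ^ n * b ^ x 1) * (c ^ x 2 * ⁅c, a⁆ ^ (n * x 0)) := by rw [cen]; simp only [mul_assoc]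
      _ = a ^ x 0 * b ^ x 1 * c ^ n * (⁅c, b⁆ ^ (n * x 1) * (c ^ x 2 * ⁅c, a⁆ ^ (n * x 0))) := by
        rw [zpow_swap hZ]; simp only [mul_assoc]
      _ = _ := by
        rw [cen]
        simp
        rw [add_comm, zpow_add]
        simp only [mul_assoc]
        rw [cen c a]
  have step : ∀ (n : ℤ) (s : K), s ∈ ({a, b, c} : Set K) → ∀ y : K, (∃ x z, y = gam a b c x * kap a b c z) →
      ∃ x z, s ^ n * y = gam a b c x * kap a b c z := by
    rintro n s hs y ⟨x, z, rfl⟩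
    rcases hs with rfl | rfl | rfl
    · exact ⟨_, _, by rw [← mul_assoc, ha, mul_assoc, ← kap_add hZ]⟩
    · exact ⟨_, _, by rw [← mul_assoc, hb, mul_assoc, ← kap_add hZ]⟩
    · exact ⟨_, _, by rw [← mul_assoc, hc, mul_assoc, ← kap_add hZ]⟩
  induction hg using Subgroup.closure_induction_left with
  | one => exact ⟨0, 0, by simp [gam, kap_zero]⟩
  | mul_left s hs y _ ih => simpa using step 1 s hs y ih
  | inv_mul_cancel s hs y _ ih => simpa using step (-1) s hs y ih

lemma c2_mul_pow (hZ : ∀ x y : K, ⁅x, y⁆ ∈ Subgroup.center K) (g h : K) (m : ℕ) :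
    (g * h) ^ m = g ^ m * h ^ m * ⁅h, g⁆ ^ (m.choose 2) := by
  induction m with
  | zero => simp
  | succ m ih =>
    have cen := (Subgroup.mem_center_iff.1 (Subgroup.pow_mem _ (hZ h g) (m.choose 2)))
    have sw := zpow_swap hZ h g m 1
    simp only [zpow_natCast, zpow_one, mul_one] at sw
    have cen2 := (Subgroup.mem_center_iff.1 (Subgroup.pow_mem _ (hZ h g) m))
    rw [pow_succ, ih, Nat.choose_succ_succ' m 1, Nat.choose_one_right]
    calc g ^ m * h ^ m * ⁅h, g⁆ ^ m.choose 2 * (g * h) = g ^ m * h ^ m * (⁅h, g⁆ ^ m.choose 2 * (g * h)) := by simp only [mul_assoc]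
      _ = g ^ m * (h ^ m * g) * h * ⁅h, g⁆ ^ m.choose 2 := by rw [← cen]; simp only [mul_assoc]
      _ = g ^ m * g * h ^ m * (⁅h, g⁆ ^ m * h) * ⁅h, g⁆ ^ m.choose 2 := by rw [sw]; simp only [mul_assoc]
      _ = _ := by rw [← cen2 h, pow_succ g, pow_succ h, pow_add ⁅h, g⁆]; simp only [mul_assoc]

end normalform

section lattice
open scoped Matrix

lemma cast_cross {n : ℕ} (x y : Fin 3 → ℤ) :
    (fun i => (((x ⨯₃ y) i : ℤ) : ZMod n)) = (fun i => (x i : ZMod n)) ⨯₃ (fun i => (y i : ZMod n)) := by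
  ext i
  fin_cases i <;> simp [cross_apply]

lemma cast_mulVec {n : ℕ} (B : Matrix (Fin 3) (Fin 3) ℤ) (x : Fin 3 → ℤ) :
    (fun i => (((B *ᵥ x) i : ℤ) : ZMod n)) = (B.map (Int.cast : ℤ → ZMod n)) *ᵥ (fun i => (x i : ZMod n)) := by
  ext i
  simp [Matrix.mulVec, dotProduct]

lemma lattice_lemma (p r : ℕ) (hp : p.Prime) (R : AddSubgroup (Fin 3 → ℤ)) (B : Matrix (Fin 3) (Fin 3) ℤ)
    (h1 : ∀ z : Fin 3 → ℤ, ((p : ℤ) ^ (r + 1)) • z ∈ R) (h2 : ∃ z : Fin 3 → ℤ, ((p : ℤ) ^ r) • z ∉ R)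
    (h3 : ∀ x, B *ᵥ x ∈ R → ∀ y, x ⨯₃ y ∈ R) :
    (∀ z ∈ R, ∀ i, (p : ℤ) ^ (r + 1) ∣ z i) ∧ ¬ (p : ℤ) ∣ B.det := by
  have : Fact p.Prime := ⟨hp⟩
  let q : (Fin 3 → ℤ) →+ (Fin 3 → ZMod p) :=
    { toFun := fun z i => (z i : ZMod p), map_zero' := by ext; simp, map_add' := by intros; ext; simp }
  let m : (Fin 3 → ℤ) →+ (Fin 3 → ℤ) := DistribSMul.toAddMonoidHom _ ((p : ℤ) ^ r)
  let S := AddSubgroup.toZModSubmodule p ((R.comap m).map q)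
  have hker : ∀ z, q z = 0 → ∃ z', z = (p : ℤ) • z' := by
    intro z hz
    have : ∀ i, ∃ k, z i = p * k := by
      intro i
      have := congrFun hz i
      exact (ZMod.intCast_zmod_eq_zero_iff_dvd _ _).1 this
    choose k hk using this
    exact ⟨k, by ext i; simp [hk]⟩
  have hSmem : ∀ z, q z ∈ S ↔ ((p : ℤ) ^ r) • z ∈ R := by
    intro z
    constructor
    · rintro ⟨y, hy, hyz⟩
      have hy' : ((p : ℤ) ^ r) • y ∈ R := hy
      obtain ⟨k, hk⟩ := hker (z - y) (by rw [map_sub, hyz, sub_self])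
      have : z = y + (p : ℤ) • k := by rw [← hk]; abel
      rw [this, smul_add, smul_smul, ← pow_succ]
      exact R.add_mem hy' (h1 k)
    · intro h
      exact ⟨z, h, rfl⟩
  have hsurj : ∀ v, ∃ z, q z = v := by
    intro v
    choose z hz using fun i => ZMod.intCast_surjective (v i)
    exact ⟨z, funext hz⟩
  have hmain := field_lemma (B.map (Int.cast : ℤ → ZMod p)) S (by
    intro htop
    obtain ⟨z, hz⟩ := h2
    apply hz
    rw [← hSmem, htop]
    trivial) (by
    intro x hx y
    obtain ⟨x, rfl⟩ := hsurj x
    obtain ⟨y, rfl⟩ := hsurj y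
    have e1 : q (B *ᵥ x) = (B.map (Int.cast : ℤ → ZMod p)) *ᵥ q x := cast_mulVec B x
    have e2 : q (x ⨯₃ y) = q x ⨯₃ q y := cast_cross x y
    rw [← e1, hSmem] at hx
    rw [← e2, hSmem]
    rw [← Matrix.mulVec_smul] at hx
    have := h3 _ hx y
    rwa [map_smul, LinearMap.smul_apply] at this)
  obtain ⟨hbot, hdet⟩ := hmain
  constructor
  · have ind : ∀ k ≤ r + 1, ∀ z ∈ R, ∃ z', z = (p : ℤ) ^ k • z' := by
      intro k
      induction k with
      | zero => intro _ z _; exact ⟨z, by simp⟩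
      | succ k ih =>
        intro hk z hz
        obtain ⟨z', rfl⟩ := ih (by omega) z hz
        have h4 : q z' ∈ S := by
          rw [hSmem]
          have := R.zsmul_mem hz ((p : ℤ) ^ (r - k))
          rwa [smul_smul, ← pow_add, show r - k + k = r by omega] at this
        rw [hbot, Submodule.mem_bot] at h4
        obtain ⟨w, rfl⟩ := hker _ h4
        exact ⟨w, by rw [smul_smul, ← pow_succ]⟩
    intro z hz i
    obtain ⟨z', rfl⟩ := ind (r + 1) le_rfl z hz
    simp
  · intro hd
    apply hdet
    have : (B.map (Int.cast : ℤ → ZMod p)).det = ((B.det : ℤ) : ZMod p) :=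
      (Int.cast_det B).symm
    rw [this, ZMod.intCast_zmod_eq_zero_iff_dvd]
    exact hd

lemma zmod_local (p r : ℕ) (hp : p.Prime) : IsLocalRing (ZMod (p ^ (r + 1))) := by
  have : Fact p.Prime := ⟨hp⟩
  have : Fact (1 < p ^ (r + 1)) := ⟨Nat.one_lt_pow (by omega) hp.one_lt⟩
  exact IsLocalRing.of_surjective' (PadicInt.toZModPow (p := p) (r + 1)) (ZMod.ringHom_surjective _)

lemma exists_int_matrix (p r : ℕ) (hp : p.Prime) (hodd : Odd p) (B : Matrix (Fin 3) (Fin 3) ℤ)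
    (hB : ¬ (p : ℤ) ∣ B.det) :
    ∃ M : Matrix (Fin 3) (Fin 3) ℤ,
      (∀ x z : Fin 3 → ℤ, (∀ i, ((p ^ (r + 1) : ℕ) : ℤ) ∣ (B *ᵥ x + z) i) →
        ∀ i, ((p ^ (r + 1) : ℕ) : ℤ) ∣ (B *ᵥ (M *ᵥ x) + M.adjugateᵀ *ᵥ z) i) ∧
      ¬ ∀ x : Fin 3 → ℤ, ∀ i, ((p ^ (r + 1) : ℕ) : ℤ) ∣ (x ⨯₃ (M *ᵥ x)) i := by
  have := zmod_local p r hp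
  set n := p ^ (r + 1) with hn
  have hunit : ∀ k : ℤ, ¬ (p : ℤ) ∣ k → IsUnit (k : ZMod n) := by
    intro k hk
    rw [ZMod.coe_int_isUnit_iff_isCoprime, hn]
    push_cast
    exact IsCoprime.pow_left (((Nat.prime_iff_prime_int.1 hp).coprime_iff_not_dvd).2 hk)
  obtain ⟨M, hM1, hM2⟩ := exists_isometry (R := ZMod n) (by
    have := hunit 2 (by
      intro h
      have h' : p ∣ 2 := by exact_mod_cast h
      have := (Nat.prime_dvd_prime_iff_eq hp Nat.prime_two).1 h'
      rw [this] at hodd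
      exact absurd hodd (by decide))
    simpa using this) (B.map (Int.cast : ℤ → ZMod n)) (by
    have e : (B.map (Int.cast : ℤ → ZMod n)).det = ((B.det : ℤ) : ZMod n) := (Int.cast_det B).symm
    rw [e]; exact hunit _ hB)
  choose Mi hMi using fun i j => ZMod.intCast_surjective (M i j)
  have hMi' : (Matrix.of Mi).map (Int.cast : ℤ → ZMod n) = M := by ext i j; simp [hMi]
  have hadj : ((Matrix.of Mi).adjugateᵀ).map (Int.cast : ℤ → ZMod n) = M.adjugateᵀ := by
    rw [← hMi']
    have := RingHom.map_adjugate (Int.castRingHom (ZMod n)) (Matrix.of Mi)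
    have h2 := congrArg Matrix.transpose this
    exact h2
  refine ⟨Matrix.of Mi, ?_, ?_⟩
  · intro x z h i
    rw [← ZMod.intCast_zmod_eq_zero_iff_dvd]
    have h' : (B.map (Int.cast : ℤ → ZMod n)) *ᵥ (fun i => (x i : ZMod n)) + (fun i => (z i : ZMod n)) = 0 := by
      rw [← cast_mulVec]
      ext i
      have := (ZMod.intCast_zmod_eq_zero_iff_dvd _ _).2 (h i)
      simpa using this
    have hz := eq_neg_of_add_eq_zero_right h'
    have e : (fun i => (((B *ᵥ ((Matrix.of Mi) *ᵥ x)) i : ℤ) : ZMod n)) +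
      (fun i => ((((Matrix.of Mi).adjugateᵀ *ᵥ z) i : ℤ) : ZMod n)) = 0 := by
      rw [cast_mulVec, cast_mulVec, cast_mulVec, hadj, hMi', hz, Matrix.mulVec_neg, Matrix.mulVec_mulVec,
        Matrix.mulVec_mulVec, hM1, add_neg_cancel]
    have := congrFun e i
    simpa using this
  · intro h
    apply hM2
    intro v
    choose x hx using fun i => ZMod.intCast_surjective (v i)
    have hv : v = fun i => (x i : ZMod n) := funext fun i => (hx i).symm
    rw [hv, ← hMi', ← cast_mulVec, ← cast_cross]
    ext i
    exact (ZMod.intCast_zmod_eq_zero_iff_dvd _ _).2 (h x i)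

end lattice

section final
open scoped Matrix

lemma commutator_eq_kap {G : Type*} [Group G] (hZ : ∀ x y : G, ⁅x, y⁆ ∈ Subgroup.center G)
    (a b c : G) (hgen : Subgroup.closure {a, b, c} = ⊤) (d : G) (hd : d ∈ commutator G) :
    ∃ z, d = kap a b c z := by
  have hle : commutator G ≤ (kapHom hZ a b c).range := by
    rw [commutator_def, Subgroup.commutator_le]
    intro x _ y _
    obtain ⟨x1, z1, rfl⟩ := normal_form hZ a b c x (hgen ▸ Subgroup.mem_top x)
    obtain ⟨y1, z2, rfl⟩ := normal_form hZ a b c y (hgen ▸ Subgroup.mem_top y)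
    have k1 : ∀ z (g : G), ⁅kap a b c z, g⁆ = 1 := fun z g =>
      commutatorElement_eq_one_iff_mul_comm.2 (Subgroup.mem_center_iff.1 (kap_mem hZ a b c z) g).symm
    have k2 : ∀ z (g : G), ⁅g, kap a b c z⁆ = 1 := fun z g =>
      commutatorElement_eq_one_iff_mul_comm.2 (Subgroup.mem_center_iff.1 (kap_mem hZ a b c z) g)
    rw [c2_mul_left hZ, c2_mul_right hZ, k1, k2, mul_one, mul_one, comm_gam_gam hZ]
    exact ⟨Multiplicative.ofAdd (crossProduct x1 y1), rfl⟩
  obtain ⟨z, hz⟩ := hle hd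
  exact ⟨z.toAdd, hz.symm⟩

lemma exists_hom {G : Type*} [Group G] (a b c a' b' c' : G) (hgen : Subgroup.closure {a, b, c} = ⊤)
    (h : ∀ g : G × G, g ∈ Subgroup.closure {(a, a'), (b, b'), (c, c')} → g.1 = 1 → g.2 = 1) :
    ∃ φ : G →* G, φ a = a' ∧ φ b = b' ∧ φ c = c' := by
  let H := Subgroup.closure {(a, a'), (b, b'), (c, c')}
  let f : H →* G := (MonoidHom.fst G G).comp H.subtype
  have hinj : Function.Injective f := by
    rw [injective_iff_map_eq_one]
    intro x hx
    apply Subtype.ext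
    exact Prod.ext hx (h x.1 x.2 hx)
  have hsurj : Function.Surjective f := by
    have : (⊤ : Subgroup G) ≤ f.range := by
      rw [← hgen, Subgroup.closure_le]
      rintro x (rfl | rfl | rfl)
      · exact ⟨⟨(x, a'), Subgroup.subset_closure (by simp)⟩, rfl⟩
      · exact ⟨⟨(x, b'), Subgroup.subset_closure (by simp)⟩, rfl⟩
      · exact ⟨⟨(x, c'), Subgroup.subset_closure (by simp)⟩, rfl⟩
    intro x
    exact this (Subgroup.mem_top x)
  let e := MulEquiv.ofBijective f ⟨hinj, hsurj⟩
  have key : ∀ x x' (hx : (x, x') ∈ H), (((MonoidHom.snd G G).comp H.subtype).comp e.symm.toMonoidHom) x = x' := by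
    intro x x' hx
    have : e.symm x = ⟨(x, x'), hx⟩ := by
      rw [MulEquiv.symm_apply_eq]; rfl
    simp [this]
  exact ⟨((MonoidHom.snd G G).comp H.subtype).comp e.symm.toMonoidHom,
    key _ _ (Subgroup.subset_closure (by simp)), key _ _ (Subgroup.subset_closure (by simp)),
    key _ _ (Subgroup.subset_closure (by simp))⟩

lemma gam_prod {G : Type*} [Group G] (a b c a' b' c' : G) (x : Fin 3 → ℤ) :
    gam (a, a') (b, b') (c, c') x = (gam a b c x, gam a' b' c' x) := rfl

lemma kap_prod {G : Type*} [Group G] (a b c a' b' c' : G) (x : Fin 3 → ℤ) :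
    kap (a, a') (b, b') (c, c') x = (kap a b c x, kap a' b' c' x) := rfl

lemma class_two_contra {G : Type*} [Group G] [Finite G] (p r : ℕ) (hp : p.Prime) (hodd : Odd p)
    (hE : IsEGroup G) (hZ : ∀ x y : G, ⁅x, y⁆ ∈ Subgroup.center G)
    (hr : Monoid.exponent (G ⧸ commutator G) = p ^ (r + 1))
    (hr' : Monoid.exponent (commutator G) = p ^ (r + 1))
    (a b c : G) (hgen : Subgroup.closure {a, b, c} = ⊤) : False := by
  set n := p ^ (r + 1) with hn
  have hG'n : ∀ x y : G, ⁅x, y⁆ ^ n = 1 := by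
    intro x y
    have hmem : ⁅x, y⁆ ∈ commutator G := Subgroup.commutator_mem_commutator (Subgroup.mem_top x) (Subgroup.mem_top y)
    have := Monoid.pow_exponent_eq_one (⟨⁅x, y⁆, hmem⟩ : commutator G)
    rw [hr'] at this
    exact congrArg Subtype.val this
  have hnodd : Odd n := hodd.pow
  have hmulpow : ∀ g h : G, (g * h) ^ n = g ^ n * h ^ n := by
    intro g h
    obtain ⟨k, hk⟩ := hnodd
    rw [c2_mul_pow hZ]
    have : n.choose 2 = n * k := by
      rw [Nat.choose_two_right, hk]
      simp only [Nat.add_sub_cancel]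
      rw [show (2 * k + 1) * (2 * k) = (2 * k + 1) * k * 2 by ring]
      simp
    rw [this, pow_mul, hG'n, one_pow, mul_one]
  let P : G →* G := { toFun := fun x => x ^ n, map_one' := one_pow n, map_mul' := hmulpow }
  have hpow : ∀ x : G, x ^ n ∈ commutator G := by
    intro x
    rw [← QuotientGroup.eq_one_iff, QuotientGroup.mk_pow, ← hr]
    exact Monoid.pow_exponent_eq_one _
  let K := kap a b c
  have hKn : ∀ z : Fin 3 → ℤ, K ((n : ℤ) • z) = 1 := by
    intro z
    simp only [K]
    rw [kap_smul hZ, kap, zpow_natCast, hmulpow, hmulpow]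
    simp only [← zpow_natCast, ← zpow_mul]
    simp only [mul_comm _ (n : ℤ), zpow_mul, zpow_natCast, hG'n, one_zpow, mul_one]
  obtain ⟨Ba, hBa⟩ := commutator_eq_kap hZ a b c hgen _ (hpow a)
  obtain ⟨Bb, hBb⟩ := commutator_eq_kap hZ a b c hgen _ (hpow b)
  obtain ⟨Bc, hBc⟩ := commutator_eq_kap hZ a b c hgen _ (hpow c)
  let B : Matrix (Fin 3) (Fin 3) ℤ := (Matrix.of ![Ba, Bb, Bc])ᵀ
  have hPgam : ∀ x, P (gam a b c x) = K (B *ᵥ x) := by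
    intro x
    have e1 : P a = kap a b c Ba := hBa
    have e2 : P b = kap a b c Bb := hBb
    have e3 : P c = kap a b c Bc := hBc
    rw [gam, map_mul, map_mul, map_zpow, map_zpow, map_zpow, e1, e2, e3, ← kap_smul hZ, ← kap_smul hZ,
      ← kap_smul hZ, ← kap_add hZ, ← kap_add hZ]
    simp only [K]
    congr 1
    ext i
    simp [B, Matrix.mulVec, dotProduct, Fin.sum_univ_three]
    ring
  -- lattice
  let R : AddSubgroup (Fin 3 → ℤ) := AddSubgroup.comap (AddMonoidHom.id _)
    (MonoidHom.toAdditiveRight (kapHom hZ a b c)).ker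
  have hR : ∀ z, z ∈ R ↔ K z = 1 := fun z => Iff.rfl
  have hcenK : ∀ x, gam a b c x ∈ Subgroup.center G → ∀ y, K (x ⨯₃ y) = 1 := by
    intro x hx y
    simp only [K]
    rw [← comm_gam_gam hZ, commutatorElement_eq_one_iff_mul_comm]
    exact (Subgroup.mem_center_iff.1 hx _).symm
  obtain ⟨hL1, hL2⟩ := lattice_lemma p r hp R B
    (fun z => by rw [hR]; have := hKn z; rw [hn] at this; exact_mod_cast this)
    (by
      by_contra hcon
      push Not at hcon
      have hd : Monoid.exponent (commutator G) ∣ p ^ r := by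
        rw [Monoid.exponent_dvd_iff_forall_pow_eq_one]
        rintro ⟨d, hd⟩
        apply Subtype.ext
        obtain ⟨z, rfl⟩ := commutator_eq_kap hZ a b c hgen d hd
        have := (hR _).1 (hcon z)
        simp only [K] at this
        rw [kap_smul hZ] at this
        show kap a b c z ^ (p ^ r) = 1
        exact_mod_cast this
      rw [hr', hn] at hd
      have h1 := Nat.le_of_dvd (pow_pos hp.pos _) hd
      have h2 := Nat.pow_lt_pow_right hp.one_lt (Nat.lt_succ_self r)
      simp only [Nat.succ_eq_add_one] at h2
      omega)
    (fun x hx y => by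
      rw [hR] at hx ⊢
      rw [← hPgam] at hx
      exact hcenK x (central_of_pow p (r + 1) hp hE hr _ hx) y)
  have hK1 : ∀ z, K z = 1 ↔ ∀ i, (n : ℤ) ∣ z i := by
    intro z
    constructor
    · intro h i
      have := hL1 z ((hR z).2 h) i
      rw [hn]; exact_mod_cast this
    · intro h
      choose k hk using h
      have : z = (n : ℤ) • k := by ext i; simp [hk]
      rw [this]; exact hKn k
  obtain ⟨M, hM1, hM2⟩ := exists_int_matrix p r hp hodd B hL2
  let a' := gam a b c (Mᵀ 0)
  let b' := gam a b c (Mᵀ 1)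
  let c' := gam a b c (Mᵀ 2)
  have hkap' : ∀ z, kap a' b' c' z = K (M.adjugateᵀ *ᵥ z) := by
    intro z
    simp only [K, a', b', c']
    rw [kap, comm_gam_gam hZ, comm_gam_gam hZ, comm_gam_gam hZ, ← kap_smul hZ, ← kap_smul hZ,
      ← kap_smul hZ, ← kap_add hZ, ← kap_add hZ]
    congr 1
    ext i
    fin_cases i <;> simp [Matrix.adjugate_fin_three, cross_apply, Matrix.mulVec, dotProduct, Fin.sum_univ_three] <;> ring
  have hgam' : ∀ x, P (gam a' b' c' x) = K (B *ᵥ (M *ᵥ x)) := by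
    intro x
    rw [gam, map_mul, map_mul, map_zpow, map_zpow, map_zpow]
    simp only [a', b', c']
    rw [hPgam, hPgam, hPgam]
    simp only [K]
    rw [← kap_smul hZ, ← kap_smul hZ, ← kap_smul hZ, ← kap_add hZ, ← kap_add hZ, ← Matrix.mulVec_smul,
      ← Matrix.mulVec_smul, ← Matrix.mulVec_smul, ← Matrix.mulVec_add, ← Matrix.mulVec_add]
    congr 2
    ext i
    simp [Matrix.mulVec, dotProduct, Fin.sum_univ_three]
    ring
  have hgamn : ∀ (a b c : G) (x : Fin 3 → ℤ), gam a b c ((n : ℤ) • x) = P (gam a b c x) := by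
    intro a b c x
    rw [gam, gam, map_mul, map_mul, map_zpow, map_zpow, map_zpow]
    simp [P, zpow_mul]
  have hZ2 : ∀ x y : G × G, ⁅x, y⁆ ∈ Subgroup.center (G × G) := by
    intro x y
    rw [Subgroup.mem_center_iff]
    intro g
    exact Prod.ext (Subgroup.mem_center_iff.1 (hZ x.1 y.1) g.1) (Subgroup.mem_center_iff.1 (hZ x.2 y.2) g.2)
  obtain ⟨φ, hφa, hφb, hφc⟩ := exists_hom a b c a' b' c' hgen (by
    intro g hg hg1
    obtain ⟨x, z, rfl⟩ := normal_form hZ2 _ _ _ g hg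
    rw [gam_prod, kap_prod] at hg1 ⊢
    change gam a b c x * kap a b c z = 1 at hg1
    change gam a' b' c' x * kap a' b' c' z = 1
    have hx : gam a b c x ∈ Subgroup.center G := by
      rw [eq_inv_of_mul_eq_one_left hg1]
      exact Subgroup.inv_mem _ (kap_mem hZ a b c z)
    have hx2 := hcenK x hx
    have hxd : ∀ i, (n : ℤ) ∣ x i := by
      have d1 := (hK1 _).1 (hx2 ![1, 0, 0])
      have d2 := (hK1 _).1 (hx2 ![0, 1, 0])
      have d11 := d1 1
      have d12 := d1 2
      have d22 := d2 2
      simp [cross_apply] at d11 d12 d22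
      intro i
      fin_cases i
      · exact d22
      · exact d12
      · exact d11
    choose x' hx' using hxd
    have : x = (n : ℤ) • x' := by ext i; simp [hx']
    subst this
    rw [hgamn, hPgam] at hg1
    rw [hgamn, hgam', hkap']
    simp only [K] at hg1 ⊢
    rw [← kap_add hZ] at hg1 ⊢
    exact (hK1 _).2 (hM1 _ _ ((hK1 _).1 hg1)))
  apply hM2
  intro x
  apply (hK1 _).1
  have h1 := hE φ (gam a b c x)
  rw [← commutatorElement_eq_one_iff_mul_comm] at h1
  have h2 : φ (gam a b c x) = gam a' b' c' x := by
    rw [gam, map_mul, map_mul, map_zpow, map_zpow, map_zpow, hφa, hφb, hφc, gam]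
  rw [h2, comm_gam_right hZ] at h1
  simp only [a', b', c'] at h1
  rw [comm_gam_gam hZ, comm_gam_gam hZ, comm_gam_gam hZ, ← kap_smul hZ, ← kap_smul hZ,
      ← kap_smul hZ, ← kap_add hZ, ← kap_add hZ, ← map_smul, ← map_smul, ← map_smul, ← map_add, ← map_add] at h1
  rw [← h1]
  simp only [K]
  congr 2
  ext i
  simp [Matrix.mulVec, dotProduct, Fin.sum_univ_three]
  ring

end final

end pEGroup

/-- If `p` is an odd prime and `G` is a non-abelian finite `p`-group that is an
`E`-group and can be generated by 3 elements, then the exponent of the derived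
subgroup `G'` is strictly smaller than the exponent of the abelianization
`G/G'`. -/
theorem nonabelian_three_generated_pEGroup_exponent_commutator_lt
    (p : ℕ) (hp : p.Prime) (hodd : Odd p) {G : Type*} [Group G] [Finite G]
    (hpG : IsPGroup p G) (hE : IsEGroup G)
    (hgen : ∃ a b c : G, Subgroup.closure {a, b, c} = ⊤)
    (hna : ∃ x y : G, x * y ≠ y * x) :
    Monoid.exponent (commutator G) < Monoid.exponent (G ⧸ commutator G) := by
  obtain ⟨a, b, c, hgen⟩ := hgen
  obtain ⟨r, hr⟩ : ∃ r, Monoid.exponent (G ⧸ commutator G) = p ^ r := by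
    have : Fact p.Prime := ⟨hp⟩
    obtain ⟨k, hk⟩ := IsPGroup.iff_card.1 (hpG.to_quotient (commutator G))
    have := Group.exponent_dvd_nat_card (G := G ⧸ commutator G)
    rw [hk] at this
    obtain ⟨m, _, hm⟩ := (Nat.dvd_prime_pow hp).1 this
    exact ⟨m, hm⟩
  have hZ := class_two p r hp hE hr a b c hgen
  have hdvd : Monoid.exponent (commutator G) ∣ p ^ r := by
    rw [Monoid.exponent_dvd_iff_forall_pow_eq_one]
    rintro ⟨d, hd⟩
    apply Subtype.ext
    show d ^ (p ^ r) = 1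
    have he := c2_engel hZ
    have hcm : ∀ x y : G, kap x y 1 ![0, 0, 1] ^ (p ^ r) = 1 := by
      intro x y
      rw [← kap_2, ← zpow_natCast, ← comm_pow_left he, commutatorElement_eq_one_iff_mul_comm]
      have hle : commutator G ≤ Subgroup.center G := by
        rw [commutator_def, Subgroup.commutator_le]
        intro x _ y _
        exact hZ x y
      have : x ^ ((p ^ r : ℕ) : ℤ) ∈ commutator G := by
        rw [← QuotientGroup.eq_one_iff, QuotientGroup.mk_zpow, zpow_natCast, ← hr]
        exact Monoid.pow_exponent_eq_one _
      exact (Subgroup.mem_center_iff.1 (hle this) y).symm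
    have hcm' : ∀ x y : G, kap x y 1 ![0, 0, 1] = x * y * x⁻¹ * y⁻¹ := by
      intro x y
      rw [← kap_2, commutatorElement_def]
    obtain ⟨z, rfl⟩ := commutator_eq_kap hZ a b c hgen d hd
    rw [← zpow_natCast, ← kap_smul hZ, kap]
    have q : ∀ x y : G, ∀ k : ℤ, kap x y 1 ![0, 0, 1] ^ (((p ^ r : ℕ) : ℤ) * k) = 1 := by
      intro x y k
      rw [zpow_mul, zpow_natCast, hcm, one_zpow]
    simp only [← kap_2 _ _ (1 : G)] at q
    simp only [Pi.smul_apply, smul_eq_mul, q, mul_one]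
  refine lt_of_le_of_ne ?_ ?_
  · rw [hr]
    exact Nat.le_of_dvd (pow_pos hp.pos _) hdvd
  · intro heq
    rw [hr] at heq
    rcases r with _ | r
    · obtain ⟨x, y, hxy⟩ := hna
      apply hxy
      have hsub := Monoid.exp_eq_one_iff.1 (heq.trans (pow_zero p))
      have hmem := Subgroup.commutator_mem_commutator (Subgroup.mem_top x) (Subgroup.mem_top y)
      have := congrArg Subtype.val (Subsingleton.elim (⟨_, hmem⟩ : commutator G) 1)
      exact commutatorElement_eq_one_iff_mul_comm.1 this
    · exact class_two_contra p r hp hodd hE hZ hr heq a b c hgen
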